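/- arXiv:1609.04560 — 8 statements merged into one kernel-verified Lean document; each statement's English description precedes it below -/
import Mathlib

section
/- Let C be an increasing-complete partially cyclically ordered set, and let (a_n) and (b_m) be compatible increasing sequences in C. Then the (unique) limits of (a_n) and (b_m) in the interval topology agree. -/
open Filter Topology

/-- The interval topology on a set with a ternary (partial cyclic order) relation:
the topology generated by the intervals `(p,q) = {x | ⟨p,x,q⟩}`. -/
def intervalTopology {C : Type*} (R : C → C → C → Prop) : TopologicalSpace C :=
  TopologicalSpace.generateFrom {I : Set C | ∃ p q : C, I = {x : C | R p x q}}

/-- A sequence is increasing for the partial cyclic order if `⟨a_i,a_j,a_k⟩` whenever `i<j<k`. -/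
def IsIncreasingSeq {C : Type*} (R : C → C → C → Prop) (s : ℕ → C) : Prop :=
  ∀ i j k : ℕ, i < j → j < k → R (s i) (s j) (s k)

theorem IsIncreasingSeq.comp_strictMono {C : Type*} {R : C → C → C → Prop} {s : ℕ → C}
    (hs : IsIncreasingSeq R s) {n : ℕ → ℕ} (hn : StrictMono n) : IsIncreasingSeq R (s ∘ n) :=
  fun _ _ _ hij hjk => hs _ _ _ (hn hij) (hn hjk)

/-- In an increasing-complete partially cyclically ordered set, compatible
increasing sequences have the same limit in the interval topology. -/
theorem limits_of_compatible_increasing_sequences_agree {C : Type*} (R : C → C → C → Prop)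
    (hcyc : ∀ a b c : C, R a b c → R b c a)
    (hasym : ∀ a b c : C, R a b c → ¬ R c b a)
    (htrans : ∀ a b c d : C, R a b c → R a c d → R a b d)
    (hcomplete : ∀ s : ℕ → C, IsIncreasingSeq R s →
      ∃! l : C, Filter.Tendsto s Filter.atTop (@nhds C (intervalTopology R) l))
    (a b : ℕ → C)
    (ha : IsIncreasingSeq R a) (hb : IsIncreasingSeq R b)
    (hcompat : ∃ n m : ℕ → ℕ, StrictMono n ∧ StrictMono m ∧
      IsIncreasingSeq R (fun p => if p % 2 = 0 then a (n (p / 2)) else b (m (p / 2))))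
    (la lb : C)
    (hla : Filter.Tendsto a Filter.atTop (@nhds C (intervalTopology R) la))
    (hlb : Filter.Tendsto b Filter.atTop (@nhds C (intervalTopology R) lb)) :
    la = lb := by
  obtain ⟨n, m, hn, hm, hc⟩ := hcompat
  obtain ⟨l, hl, -⟩ := hcomplete _ hc
  have hal : Tendsto (a ∘ n) atTop (@nhds C (intervalTopology R) l) := by
    have h := hl.comp (strictMono_mul_left_of_pos (two_pos : 0 < 2)).tendsto_atTop
    refine h.congr fun k => ?_
    simp
  have hbl : Tendsto (b ∘ m) atTop (@nhds C (intervalTopology R) l) := by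
    have hodd : StrictMono fun k : ℕ => 2 * k + 1 := fun i j hij => by dsimp only; omega
    refine (hl.comp hodd.tendsto_atTop).congr fun k => ?_
    have h1 : (2 * k + 1) % 2 = 1 := by omega
    have h2 : (2 * k + 1) / 2 = k := by omega
    simp [h1, h2]
  have hla' : la = l := (hcomplete _ (ha.comp_strictMono hn)).unique
    (hla.comp hn.tendsto_atTop) hal
  have hlb' : lb = l := (hcomplete _ (hb.comp_strictMono hm)).unique
    (hlb.comp hm.tendsto_atTop) hbl
  exact hla'.trans hlb'.symm
end

section
/- Let C be a partially cyclically ordered set which is full and proper, and let (x_1,x_2,x_3,x_4,x_5,x_6) ∈ C^6 be a cycle. Let a_1 be in the closure (in the interval topology) of the interval (x_1,x_2), a_2 in the closure of (x_3,x_4), and a_3 in the closure of (x_5,x_6). Then ⟨a_1,a_2,a_3⟩. -/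
/-- In a full and proper partially cyclically ordered set, for a cycle
`(x₁,…,x₆)` and points `a₁,a₂,a₃` in the closures of `(x₁,x₂)`, `(x₃,x₄)`, `(x₅,x₆)`
respectively, we have `⟨a₁,a₂,a₃⟩`. -/
theorem cycle_of_closures {C : Type*} (R : C → C → C → Prop)
    (hcyc : ∀ a b c : C, R a b c → R b c a)
    (hasym : ∀ a b c : C, R a b c → ¬ R c b a)
    (htrans : ∀ a b c d : C, R a b c → R a c d → R a b d)
    (hfull : ∀ a b : C, (∃ x, R a x b) → ∃ x, R b x a)
    (hproper : ∀ a b c d : C, R a b c → R a b d → R a c d → R b c d →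
      @closure C (intervalTopology R) {x | R b x c} ⊆ {x | R a x d})
    (x : Fin 6 → C)
    (hx : ∀ i j k : Fin 6, i < j → j < k → R (x i) (x j) (x k))
    (a₁ a₂ a₃ : C)
    (h₁ : a₁ ∈ @closure C (intervalTopology R) {t | R (x 0) t (x 1)})
    (h₂ : a₂ ∈ @closure C (intervalTopology R) {t | R (x 2) t (x 3)})
    (h₃ : a₃ ∈ @closure C (intervalTopology R) {t | R (x 4) t (x 5)}) :
    R a₁ a₂ a₃ := by
  have key : ∀ a b c d : C, R a b c → R a c d → R b c d := fun a b c d h h' =>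
    hcyc _ _ _ (hcyc _ _ _ (htrans c d a b (hcyc _ _ _ h') (hcyc _ _ _ (hcyc _ _ _ h))))
  have h012 : R (x 0) (x 1) (x 2) := hx 0 1 2 (by decide) (by decide)
  have h015 : R (x 0) (x 1) (x 5) := hx 0 1 5 (by decide) (by decide)
  have h025 : R (x 0) (x 2) (x 5) := hx 0 2 5 (by decide) (by decide)
  have h125 : R (x 1) (x 2) (x 5) := hx 1 2 5 (by decide) (by decide)
  have h234 : R (x 2) (x 3) (x 4) := hx 2 3 4 (by decide) (by decide)
  have h235 : R (x 2) (x 3) (x 5) := hx 2 3 5 (by decide) (by decide)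
  have h245 : R (x 2) (x 4) (x 5) := hx 2 4 5 (by decide) (by decide)
  have h345 : R (x 3) (x 4) (x 5) := hx 3 4 5 (by decide) (by decide)
  have rot : ∀ a b c : C, R a b c → R c a b := fun a b c h => hcyc _ _ _ (hcyc _ _ _ h)
  have e₁ : R (x 5) a₁ (x 2) :=
    hproper (x 5) (x 0) (x 1) (x 2) (rot _ _ _ h015) (rot _ _ _ h025) (rot _ _ _ h125) h012 h₁
  have a23 : R a₁ (x 2) (x 3) := key _ _ _ _ e₁ (rot _ _ _ h235)
  have a24 : R a₁ (x 2) (x 4) := key _ _ _ _ e₁ (rot _ _ _ h245)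
  have a34 : R a₁ (x 3) (x 4) :=
    key _ _ _ _ (htrans _ _ _ _ e₁ (rot _ _ _ h235)) (rot _ _ _ h345)
  have e₂ : R a₁ a₂ (x 4) := hproper a₁ (x 2) (x 3) (x 4) a23 a24 a34 h234 h₂
  have a45 : R a₁ (x 4) (x 5) := hcyc _ _ _ (htrans _ _ _ _ e₁ (rot _ _ _ h245))
  have e₃ : R a₂ a₃ a₁ :=
    hproper a₂ (x 4) (x 5) a₁ (key _ _ _ _ e₂ a45) (hcyc _ _ _ e₂)
      (hcyc _ _ _ (htrans _ _ _ _ e₂ a45)) (hcyc _ _ _ a45) h₃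
  exact rot _ _ _ e₃
end

section
/- Let C be a proper, increasing-complete partially cyclically ordered set. Let (P_n) be an increasing sequence in C converging to P in the interval topology, and let (Q_n) be a sequence with Q_n in the closure (in the interval topology) of the interval (P_n,P_{n+1}) for every n. Then (Q_n) converges to P, and (Q_n) is 3-increasing, i.e. ⟨Q_i,Q_j,Q_k⟩ whenever i+2 < j < k−2. -/
open Filter Topology

section PartialCyclicOrder

variable {C : Type*} {R : C → C → C → Prop}

/-- Elements in order for the cut `R p` are in cyclic order. -/
theorem cyclic_of_cut (hcyc : ∀ a b c : C, R a b c → R b c a)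
    (htrans : ∀ a b c d : C, R a b c → R a c d → R a b d)
    {p x y z : C} (hxy : R p x y) (hyz : R p y z) : R x y z :=
  hcyc _ _ _ (hcyc _ _ _ (htrans _ _ _ _ (hcyc _ _ _ hyz) (hcyc _ _ _ (hcyc _ _ _ hxy))))

theorem cut_left_of_between (hcyc : ∀ a b c : C, R a b c → R b c a)
    (htrans : ∀ a b c d : C, R a b c → R a c d → R a b d)
    {p a x b : C} (hab : R p a b) (hx : R a x b) : R p a x :=
  hcyc _ _ _ (hcyc _ _ _ (htrans _ _ _ _ hx (hcyc _ _ _ hab)))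

theorem cut_right_of_between (hcyc : ∀ a b c : C, R a b c → R b c a)
    (htrans : ∀ a b c d : C, R a b c → R a c d → R a b d)
    {p a x b : C} (hab : R p a b) (hx : R a x b) : R p x b :=
  hcyc _ _ _ (htrans _ _ _ _ (hcyc _ _ _ (hcyc _ _ _ hab)) (hcyc _ _ _ (hcyc _ _ _ hx)))

/-- A sequence is increasing if every initial segment is a chain for some cut. -/
theorem isIncreasingSeq_of_cuts (hcyc : ∀ a b c : C, R a b c → R b c a)
    (htrans : ∀ a b c d : C, R a b c → R a c d → R a b d) {s : ℕ → C}
    (h : ∀ N, ∃ p, ∀ i < N, R p (s i) (s (i + 1))) : IsIncreasingSeq R s := by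
  intro i j k hij hjk
  obtain ⟨p, hp⟩ := h k
  have chain : ∀ a b, a < b → b ≤ k → R p (s a) (s b) := by
    intro a b hab
    induction b, hab using Nat.le_induction with
    | base => exact fun hb => hp a hb
    | succ b _ ih => exact fun hb => htrans _ _ _ _ (ih (by omega)) (hp b hb)
  exact cyclic_of_cut hcyc htrans (chain i j hij hjk.le) (chain j k hjk le_rfl)

theorem IsIncreasingSeq.between_of_mem_closure
    (hproper : ∀ a b c d : C, R a b c → R a b d → R a c d → R b c d →
      @closure C (intervalTopology R) {x | R b x c} ⊆ {x | R a x d})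
    {P : ℕ → C} (hP : IsIncreasingSeq R P) {Q : ℕ → C}
    (hQ : ∀ n : ℕ, Q n ∈ @closure C (intervalTopology R) {x | R (P n) x (P (n + 1))})
    (n : ℕ) : R (P n) (Q (n + 1)) (P (n + 3)) :=
  hproper _ _ _ _ (hP _ _ _ (by omega) (by omega)) (hP _ _ _ (by omega) (by omega))
    (hP _ _ _ (by omega) (by omega)) (hP _ _ _ (by omega) (by omega)) (hQ (n + 1))

theorem IsIncreasingSeq.cut_of_mem_closure (hcyc : ∀ a b c : C, R a b c → R b c a)
    (hproper : ∀ a b c d : C, R a b c → R a b d → R a c d → R b c d →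
      @closure C (intervalTopology R) {x | R b x c} ⊆ {x | R a x d})
    {P : ℕ → C} (hP : IsIncreasingSeq R P) {Q : ℕ → C}
    (hQ : ∀ n : ℕ, Q n ∈ @closure C (intervalTopology R) {x | R (P n) x (P (n + 1))})
    {n m : ℕ} (hm : n + 2 < m) : R (P m) (Q n) (P (n + 2)) := by
  have cut : ∀ a b, a < b → b < m → R (P m) (P a) (P b) := fun a b hab hb =>
    hcyc _ _ _ (hcyc _ _ _ (hP a b m hab hb))
  exact hproper _ _ _ _ (cut _ _ (by omega) (by omega)) (cut _ _ (by omega) (by omega))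
    (cut _ _ (by omega) (by omega)) (hP _ _ _ (by omega) (by omega)) (hQ n)

/-- Along a residue class modulo 3, interleaving `P` and `Q` gives an increasing sequence. -/
theorem tendsto_residue (hcyc : ∀ a b c : C, R a b c → R b c a)
    (htrans : ∀ a b c d : C, R a b c → R a c d → R a b d)
    (hcomplete : ∀ s : ℕ → C, IsIncreasingSeq R s →
      ∃! l : C, Tendsto s atTop (@nhds C (intervalTopology R) l))
    {P Q : ℕ → C} {Plim : C} (hP : IsIncreasingSeq R P)
    (hPlim : Tendsto P atTop (@nhds C (intervalTopology R) Plim))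
    (hPQ : ∀ n, R (P n) (Q (n + 1)) (P (n + 3))) (r : ℕ) :
    Tendsto (fun m => Q (3 * m + r + 1)) atTop (@nhds C (intervalTopology R) Plim) := by
  let s : ℕ → C := fun n =>
    if Even n then P (3 * (n / 2) + r) else Q (3 * (n / 2) + r + 1)
  have s_even : ∀ m, s (2 * m) = P (3 * m + r) := fun m => by simp [s]
  have s_odd : ∀ m, s (2 * m + 1) = Q (3 * m + r + 1) := fun m => by
    have : (2 * m + 1) / 2 = m := by omega
    simp [s, this]
  have hs : IsIncreasingSeq R s := by
    refine isIncreasingSeq_of_cuts hcyc htrans fun N => ⟨P (3 * N + r + 4), fun i hi => ?_⟩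
    obtain ⟨m, rfl | rfl⟩ := i.even_or_odd'
    all_goals
      have hm : R (P (3 * N + r + 4)) (P (3 * m + r)) (P (3 * m + r + 3)) :=
        hcyc _ _ _ (hcyc _ _ _ (hP _ _ _ (by omega) (by omega)))
    · rw [s_even, s_odd]
      exact cut_left_of_between hcyc htrans hm (hPQ _)
    · rw [s_odd, show 2 * m + 1 + 1 = 2 * (m + 1) by ring, s_even,
        show 3 * (m + 1) + r = 3 * m + r + 3 by ring]
      exact cut_right_of_between hcyc htrans hm (hPQ _)
  obtain ⟨l, hl, -⟩ := hcomplete s hs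
  have hsub : IsIncreasingSeq R fun m => P (3 * m + r) := fun i j k hij hjk =>
    hP _ _ _ (by omega) (by omega)
  have tendsto_sub : Tendsto (fun m => P (3 * m + r)) atTop (@nhds C (intervalTopology R) l) := by
    simpa only [Function.comp_def, s_even] using
      hl.comp (tendsto_atTop_mono (fun m => (by omega : m ≤ 2 * m)) tendsto_id)
  have hlim : l = Plim := (hcomplete _ hsub).unique tendsto_sub
    (hPlim.comp (tendsto_atTop_mono (fun m => (by omega : m ≤ 3 * m + r)) tendsto_id))
  subst hlim
  simpa only [Function.comp_def, s_odd] using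
    hl.comp (tendsto_atTop_mono (fun m => (by omega : m ≤ 2 * m + 1)) tendsto_id)

end PartialCyclicOrder

/-- nested sequences. If `P_n → P` is increasing in a proper,
increasing-complete PCO set and `Q_n ∈ closure (P_n, P_{n+1})` for all `n`, then
`Q_n → P` and `Q` is 3-increasing: `⟨Q_i,Q_j,Q_k⟩` whenever `i+2 < j < k-2`. -/
theorem nested_sequences_converge {C : Type*} (R : C → C → C → Prop)
    (hcyc : ∀ a b c : C, R a b c → R b c a)
    (hasym : ∀ a b c : C, R a b c → ¬ R c b a)
    (htrans : ∀ a b c d : C, R a b c → R a c d → R a b d)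
    (hproper : ∀ a b c d : C, R a b c → R a b d → R a c d → R b c d →
      @closure C (intervalTopology R) {x | R b x c} ⊆ {x | R a x d})
    (hcomplete : ∀ s : ℕ → C, IsIncreasingSeq R s →
      ∃! l : C, Filter.Tendsto s Filter.atTop (@nhds C (intervalTopology R) l))
    (P : ℕ → C) (Plim : C)
    (hP : IsIncreasingSeq R P)
    (hPlim : Filter.Tendsto P Filter.atTop (@nhds C (intervalTopology R) Plim))
    (Q : ℕ → C)
    (hQ : ∀ n : ℕ, Q n ∈ @closure C (intervalTopology R) {x | R (P n) x (P (n + 1))}) :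
    Filter.Tendsto Q Filter.atTop (@nhds C (intervalTopology R) Plim) ∧
      ∀ i j k : ℕ, i + 2 < j → j + 2 < k → R (Q i) (Q j) (Q k) := by
  have hPQ := hP.between_of_mem_closure hproper hQ
  refine ⟨fun U hU => ?_, fun i j k hij hjk => ?_⟩
  · have residue : ∀ r, ∃ N, ∀ m ≥ N, Q (3 * m + r + 1) ∈ U := fun r =>
      eventually_atTop.1 (tendsto_residue hcyc htrans hcomplete hP hPlim hPQ r hU)
    choose N hN using residue
    refine eventually_atTop.2 ⟨3 * (N 0 + N 1 + N 2) + 1, fun n hn => ?_⟩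
    have hr : (n - 1) % 3 < 3 := Nat.mod_lt _ (by norm_num)
    have hNr : N ((n - 1) % 3) ≤ N 0 + N 1 + N 2 := by
      interval_cases (n - 1) % 3 <;> omega
    have hn' : 3 * ((n - 1) / 3) + (n - 1) % 3 + 1 = n := by omega
    have := hN ((n - 1) % 3) ((n - 1) / 3) (by omega)
    rwa [hn'] at this
  · obtain ⟨j, rfl⟩ : ∃ j', j = j' + 1 := ⟨j - 1, by omega⟩
    obtain ⟨k, rfl⟩ : ∃ k', k = k' + 1 := ⟨k - 1, by omega⟩
    have cut : ∀ a b, a < b → b < k + 4 → R (P (k + 4)) (P a) (P b) := fun a b hab hb =>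
      hcyc _ _ _ (hcyc _ _ _ (hP a b _ hab hb))
    have hle : ∀ {x a b}, R (P (k + 4)) x (P a) → a ≤ b → b < k + 4 →
        R (P (k + 4)) x (P b) := by
      intro x a b hx hab hb
      rcases hab.eq_or_lt with rfl | hlt
      · exact hx
      · exact htrans _ _ _ _ hx (cut a b hlt hb)
    have left : ∀ n ≤ k, R (P (k + 4)) (P n) (Q (n + 1)) := fun n hn =>
      cut_left_of_between hcyc htrans (cut n (n + 3) (by omega) (by omega)) (hPQ n)
    have right : ∀ n ≤ k + 1, R (P (k + 4)) (Q n) (P (n + 2)) := fun n hn =>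
      hP.cut_of_mem_closure hcyc hproper hQ (by omega)
    exact cyclic_of_cut hcyc htrans
      (htrans _ _ _ _ (hle (right i (by omega)) (by omega) (by omega)) (left j (by omega)))
      (htrans _ _ _ _ (hle (right (j + 1) (by omega)) (by omega) (by omega)) (left k le_rfl))
end

section
/- Let C be a partially cyclically ordered set, let g ≥ 2, and for each i ∈ {1,…,g} let points a_i^+, b_i^+, a_i^−, b_i^− ∈ C be given such that each interval (a_i^+,b_i^+) and (a_i^−,b_i^−) is nonempty and such that for some enumeration (i_1,ε_1),…,(i_{2g},ε_{2g}) of the 2g pairs {1,…,g}×{+,−}, the 4g-tuple (a_{i_1}^{ε_1}, b_{i_1}^{ε_1}, a_{i_2}^{ε_2}, b_{i_2}^{ε_2}, …, a_{i_{2g}}^{ε_{2g}}, b_{i_{2g}}^{ε_{2g}}) is a cycle. Let h_1,…,h_g be automorphisms of the partial cyclic order on C with h_i(b_i^−) = a_i^+ and h_i(a_i^−) = b_i^+ for every i. Then h_1,…,h_g generate a free subgroup of the automorphism group of C, freely generated by h_1,…,h_g (i.e. the induced homomorphism from the free group on g generators is injective). -/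
/-- Applying a nonempty reduced word to a point of a ping-pong set which is not the one repelled by
the last letter gives a point of the ping-pong set of the first letter. -/
theorem FreeGroup.prod_reduced_word_mem_of_ping_pong {ι X : Type*} (f : ι → Equiv.Perm X)
    (J : ι × Bool → Set X)
    (hJ : ∀ s t : ι × Bool, t ≠ (s.1, !s.2) →
      ∀ x ∈ J t, (cond s.2 (f s.1) (f s.1)⁻¹ : Equiv.Perm X) x ∈ J s)
    (t : ι × Bool) (x : X) (hx : x ∈ J t) (L : List (ι × Bool)) (s : ι × Bool)
    (hred : FreeGroup.IsReduced (s :: L))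
    (hlast : ∀ l ∈ (s :: L).getLast?, t ≠ (l.1, !l.2)) :
    ((s :: L).map fun y => cond y.2 (f y.1) (f y.1)⁻¹).prod x ∈ J s := by
  induction L generalizing s with
  | nil => simpa using hJ s t (hlast s (by simp)) x hx
  | cons r L ih =>
    rw [FreeGroup.isReduced_cons_cons] at hred
    rw [List.map_cons, List.prod_cons, Equiv.Perm.mul_apply]
    refine hJ s r ?_ _ (ih r hred.2 (by simpa using hlast))
    rintro rfl
    simpa using hred.1 rfl

/-- A ping-pong lemma for free groups: the ping-pong sets are pairwise disjoint, each generator or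
inverse maps every ping-pong set other than its repelling one into its attracting one, and there
are at least two generators. -/
theorem FreeGroup.lift_injective_of_disjoint_ping_pong {ι X : Type*} [Nontrivial ι]
    (f : ι → Equiv.Perm X) (J : ι × Bool → Set X)
    (hne : ∀ s, (J s).Nonempty)
    (hdisj : ∀ s t, s ≠ t → Disjoint (J s) (J t))
    (hJ : ∀ s t : ι × Bool, t ≠ (s.1, !s.2) →
      ∀ x ∈ J t, (cond s.2 (f s.1) (f s.1)⁻¹ : Equiv.Perm X) x ∈ J s) :
    Function.Injective (FreeGroup.lift f) := by
  classical
  rw [injective_iff_map_eq_one]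
  intro w hw
  by_contra hne_one
  obtain ⟨s, L, hL⟩ : ∃ s L, w.toWord = s :: L :=
    List.exists_cons_of_ne_nil fun h => hne_one (FreeGroup.toWord_eq_nil_iff.mp h)
  have hred : FreeGroup.IsReduced (s :: L) := hL ▸ FreeGroup.isReduced_toWord
  obtain ⟨t, hts, htl⟩ : ∃ t : ι × Bool, t ≠ s ∧
      ∀ l ∈ (s :: L).getLast?, t ≠ (l.1, !l.2) := by
    obtain ⟨i, hi⟩ := exists_ne s.1
    set l := (s :: L).getLast (by simp) with hl
    refine ⟨(i, l.2), fun h => hi (congrArg Prod.fst h), fun m hm => ?_⟩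
    rw [List.getLast?_eq_some_getLast (by simp), Option.mem_some_iff] at hm
    subst hm
    simp [← hl]
  obtain ⟨x, hx⟩ := hne t
  have hmem := FreeGroup.prod_reduced_word_mem_of_ping_pong f J hJ t x hx L s hred htl
  rw [← FreeGroup.lift_mk, ← hL, FreeGroup.mk_toWord, hw] at hmem
  exact Set.disjoint_left.mp (hdisj t s hts) hx hmem


/-- generalized Schottky groups are free.  Here `A i ε` (resp. `B i ε`) is the
left (resp. right) endpoint `a_i^ε` (resp. `b_i^ε`) of the Schottky interval `J_i^ε`, where
`ε = true` stands for `+` and `ε = false` for `-`.  The enumeration of the `2g` intervals is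
given by the equivalence `σ`, and `T` is the resulting `4g`-tuple
`(a_{i₁}^{ε₁}, b_{i₁}^{ε₁}, …, a_{i_{2g}}^{ε_{2g}}, b_{i_{2g}}^{ε_{2g}})`, which is assumed to
be a cycle.  The automorphisms `h i` of the partial cyclic order pair the intervals:
`h i (b_i^-) = a_i^+` and `h i (a_i^-) = b_i^+`.  Then `h 1, …, h g` freely generate a free
subgroup of the automorphism group of `C`. -/
theorem schottky_group_is_free {C : Type*} (R : C → C → C → Prop)
    (hcyc : ∀ a b c : C, R a b c → R b c a)
    (hasym : ∀ a b c : C, R a b c → ¬ R c b a)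
    (htrans : ∀ a b c d : C, R a b c → R a c d → R a b d)
    (g : ℕ) (hg : 2 ≤ g)
    (A B : Fin g → Bool → C)
    (hnonempty : ∀ (i : Fin g) (ε : Bool), ∃ x, R (A i ε) x (B i ε))
    (σ : Fin (2 * g) ≃ Fin g × Bool)
    (T : ℕ → C)
    (hTa : ∀ p : Fin (2 * g), T (2 * p.val) = A (σ p).1 (σ p).2)
    (hTb : ∀ p : Fin (2 * g), T (2 * p.val + 1) = B (σ p).1 (σ p).2)
    (hcycle : ∀ i j k : ℕ, i < j → j < k → k < 4 * g → R (T i) (T j) (T k))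
    (h : Fin g → Equiv.Perm C)
    (hinc : ∀ (i : Fin g) (a b c : C), R a b c → R (h i a) (h i b) (h i c))
    (hinv : ∀ (i : Fin g) (a b c : C), R a b c → R ((h i)⁻¹ a) ((h i)⁻¹ b) ((h i)⁻¹ c))
    (hpair₁ : ∀ i : Fin g, h i (B i false) = A i true)
    (hpair₂ : ∀ i : Fin g, h i (A i false) = B i true) :
    Function.Injective ⇑(FreeGroup.lift (fun i : Fin g => h i) : FreeGroup (Fin g) →* Equiv.Perm C) := by
  have : Nontrivial (Fin g) := Fin.nontrivial_iff_two_le.mpr hg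
  have hthree : ∀ s t : Fin g × Bool, s ≠ t → R (A s.1 s.2) (B s.1 s.2) (A t.1 t.2) := by
    intro s t hst
    obtain ⟨p, rfl⟩ := σ.surjective s
    obtain ⟨q, rfl⟩ := σ.surjective t
    have hpq : p.val ≠ q.val := fun h => hst (congrArg σ (Fin.ext h))
    rw [← hTa, ← hTb, ← hTa]
    rcases lt_or_gt_of_ne hpq with hlt | hlt
    · exact hcycle _ _ _ (by omega) (by omega) (by omega)
    · exact hcyc _ _ _ (hcycle _ _ _ (by omega) (by omega) (by omega))
  have hcompl : ∀ s t : Fin g × Bool, s ≠ t → ∀ x, R (A s.1 s.2) x (B s.1 s.2) →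
      R (B t.1 t.2) x (A t.1 t.2) := by
    intro s t hst x hx
    have hxt := htrans _ _ _ _ hx (hthree s t hst)
    exact hcyc _ _ _ (htrans _ _ _ _ (hthree t s hst.symm) (hcyc _ _ _ (hcyc _ _ _ hxt)))
  refine FreeGroup.lift_injective_of_disjoint_ping_pong h
    (fun s => {x | R (A s.1 s.2) x (B s.1 s.2)}) (fun s => hnonempty s.1 s.2) ?_ ?_
  · intro s t hst
    exact Set.disjoint_left.mpr fun x hxs hxt => hasym _ _ _ hxt (hcompl s t hst x hxs)
  · rintro ⟨i, ε⟩ t ht x hx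
    have hxc := hcompl t _ ht x hx
    cases ε with
    | true =>
      have hmap := hinc i _ _ _ hxc
      simpa [hpair₁, hpair₂] using hmap
    | false =>
      have hmap := hinv i _ _ _ hxc
      simpa [← hpair₁, ← hpair₂] using hmap
end

section
/- Let S¹ = ℝ/ℤ with the cyclic order induced from ℝ (⟨x,y,z⟩ iff there are lifts x̃ < ỹ < z̃ < x̃+1), and its standard topology. Let C be a partially cyclically ordered set that is first countable (in the interval topology), increasing-complete, full and proper. Let D ⊆ S¹ be a dense subset, let Γ be a group acting on S¹ by cyclic-order-preserving bijections with γ(D) = D for all γ ∈ Γ, and acting on C by automorphisms of its partial cyclic order. Let ξ₀ : D → C be increasing and Γ-equivariant. Then there exists a map ξ : S¹ → C which is increasing (⟨x,y,z⟩ implies ⟨ξ(x),ξ(y),ξ(z)⟩ for distinct x,y,z), Γ-equivariant, left-continuous, and satisfies: for every x ∈ S¹ and every increasing sequence (x_n) in D converging to x from the left, ξ₀(x_n) converges to ξ(x) in the interval topology of C. -/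
open Filter Topology

/-- The standard cyclic order on `S¹ = ℝ/ℤ`: `⟨x,y,z⟩` iff there are lifts
`x̃ < ỹ < z̃ < x̃ + 1`. -/
def cycS1 (x y z : AddCircle (1 : ℝ)) : Prop :=
  ∃ a b c : ℝ, (↑a : AddCircle (1 : ℝ)) = x ∧ (↑b : AddCircle (1 : ℝ)) = y ∧
    (↑c : AddCircle (1 : ℝ)) = z ∧ a < b ∧ b < c ∧ c < a + 1

/-- A sequence in `S¹` converges to `x` from the left: it converges to `x` in the standard
topology and eventually lies in an interval `(z, x)` of the cyclic order. -/
def ConvLeft (s : ℕ → AddCircle (1 : ℝ)) (x : AddCircle (1 : ℝ)) : Prop :=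
  Filter.Tendsto s Filter.atTop (nhds x) ∧
    ∃ z : AddCircle (1 : ℝ), ∀ᶠ n in Filter.atTop, cycS1 z (s n) x

/-- The set `G`, seen as a multivalued map from `ℝ` to `C`, increases on every window of
length `1`. -/
def CyclicMono {C : Type*} (R : C → C → C → Prop) (G : Set (ℝ × C)) : Prop :=
  ∀ p ∈ G, ∀ q ∈ G, ∀ r ∈ G, p.1 < q.1 → q.1 < r.1 → r.1 < p.1 + 1 → R p.2 q.2 r.2

/-- The points of `G` lie over a dense set of reals. -/
def DenseFst {C : Type*} (G : Set (ℝ × C)) : Prop :=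
  ∀ a b : ℝ, a < b → ∃ p ∈ G, a < p.1 ∧ p.1 < b

/-- The multivalued map `G` has left limit `l` at `t`, in the interval topology. -/
def HasLeftLim {C : Type*} (R : C → C → C → Prop) (G : Set (ℝ × C)) (t : ℝ) (l : C) : Prop :=
  ∀ U ∈ @nhds C (intervalTopology R) l, ∃ a < t, ∀ p ∈ G, a < p.1 → p.1 < t → p.2 ∈ U

/-- Every increasing sequence has a unique limit in the interval topology. -/
def IncreasingComplete {C : Type*} (R : C → C → C → Prop) : Prop :=
  ∀ s : ℕ → C, (∀ i j k : ℕ, i < j → j < k → R (s i) (s j) (s k)) →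
    ∃! l : C, Filter.Tendsto s Filter.atTop (@nhds C (intervalTopology R) l)

theorem exists_strictMono_fst {C : Type*} (Q : ℕ → ℝ × C → Prop) (t : ℝ)
    (h : ∀ n, ∀ a < t, ∃ p, Q n p ∧ a < p.1 ∧ p.1 < t) :
    ∃ w : ℕ → ℝ × C, (∀ n, Q n (w n)) ∧ StrictMono (fun n => (w n).1) ∧
      (∀ n : ℕ, t - 1 / ((n : ℝ) + 1) < (w n).1) ∧ ∀ n, (w n).1 < t := by
  have h' : ∀ (n : ℕ) (a : Set.Iio t), ∃ p : ℝ × C,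
      Q n p ∧ t - 1 / ((n : ℝ) + 1) < p.1 ∧ a.1 < p.1 ∧ p.1 < t := by
    intro n a
    have hn : t - 1 / ((n : ℝ) + 1) < t := by
      have : 0 < 1 / ((n : ℝ) + 1) := by positivity
      linarith
    obtain ⟨p, hp, hap, hpt⟩ := h n (max a.1 (t - 1 / ((n : ℝ) + 1))) (max_lt a.2 hn)
    exact ⟨p, hp, (le_max_right _ _).trans_lt hap, (le_max_left _ _).trans_lt hap, hpt⟩
  choose f hQ hf hlt hft using h'
  let v : ℕ → Set.Iio t := fun n =>
    Nat.rec ⟨t - 1, by simp⟩ (fun n a => ⟨(f n a).1, hft n a⟩) n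
  have hv : ∀ n, (v (n + 1)).1 = (f n (v n)).1 := fun n => rfl
  refine ⟨fun n => f n (v n), fun n => hQ _ _, strictMono_nat_of_lt_succ fun n => ?_,
    fun n => hf _ _, fun n => hft _ _⟩
  have := hlt (n + 1) (v (n + 1))
  rwa [hv] at this

theorem CyclicMono.increasing {C : Type*} {R : C → C → C → Prop} {G : Set (ℝ × C)}
    (hG : CyclicMono R G) {t : ℝ} {w : ℕ → ℝ × C} (hw : ∀ n, w n ∈ G)
    (hmono : StrictMono fun n => (w n).1) (hlow : ∀ n : ℕ, t - 1 / ((n : ℝ) + 1) < (w n).1)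
    (hup : ∀ n, (w n).1 < t) (i j k : ℕ) (hij : i < j) (hjk : j < k) :
    R (w i).2 (w j).2 (w k).2 := by
  refine hG _ (hw i) _ (hw j) _ (hw k) (hmono hij) (hmono hjk) ?_
  have h0 := hlow i
  have hk := hup k
  have hi : 1 / ((i : ℝ) + 1) ≤ 1 := by
    rw [div_le_one (by positivity)]
    linarith [(Nat.cast_nonneg i : (0 : ℝ) ≤ i)]
  linarith

theorem eventually_lt_of_sub_one_div_lt {u : ℕ → ℝ} {t a : ℝ}
    (hlow : ∀ n : ℕ, t - 1 / ((n : ℝ) + 1) < u n) (ha : a < t) : ∀ᶠ n in atTop, a < u n := by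
  have h := (tendsto_one_div_add_atTop_nhds_zero_nat (𝕜 := ℝ)).eventually_lt_const
    (sub_pos.2 ha)
  filter_upwards [h] with n hn
  linarith [hlow n]

theorem exists_hasLeftLim {C : Type*} {R : C → C → C → Prop} (hcomplete : IncreasingComplete R)
    {G : Set (ℝ × C)} (hG : CyclicMono R G) (hd : DenseFst G) (t : ℝ) :
    ∃ l, HasLeftLim R G t l := by
  obtain ⟨u, huG, humono, hulow, huup⟩ := exists_strictMono_fst (fun _ p => p ∈ G) t
    fun _ a ha => hd a t ha
  obtain ⟨l, hl, -⟩ := hcomplete _ (hG.increasing huG humono hulow huup)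
  refine ⟨l, ?_⟩
  by_contra hcon
  simp only [HasLeftLim] at hcon
  push Not at hcon
  obtain ⟨U, hU, hcon⟩ := hcon
  obtain ⟨w, hQ, hwmono, hwlow, hwup⟩ := exists_strictMono_fst
    (fun n p => p ∈ G ∧ (Even n → ∃ k ≥ n, p = u k) ∧ (¬ Even n → p.2 ∉ U)) t (by
      intro n a ha
      by_cases hn : Even n
      · obtain ⟨k, hk, hkn⟩ :=
          ((eventually_lt_of_sub_one_div_lt hulow ha).and (eventually_ge_atTop n)).exists
        exact ⟨u k, ⟨huG k, fun _ => ⟨k, hkn, rfl⟩, fun h => absurd hn h⟩, hk, huup k⟩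
      · obtain ⟨p, hp, hap, hpt, hpU⟩ := hcon a ha
        exact ⟨p, ⟨hp, fun h => absurd h hn, fun _ => hpU⟩, hap, hpt⟩)
  have hinc := hG.increasing (fun n => (hQ n).1) hwmono hwlow hwup
  obtain ⟨l', hl', -⟩ := hcomplete _ hinc
  have heven : Tendsto (fun n : ℕ => 2 * n) atTop atTop :=
    tendsto_atTop_mono (fun n => by simp only [id]; omega) tendsto_id
  have hodd : Tendsto (fun n : ℕ => 2 * n + 1) atTop atTop :=
    tendsto_atTop_mono (fun n => by simp only [id]; omega) tendsto_id
  have h1 : Tendsto (fun n => (w (2 * n)).2) atTop (@nhds C (intervalTopology R) l) := by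
    choose k hk hwk using fun n => (hQ (2 * n)).2.1 (even_two_mul n)
    simp only [hwk]
    exact hl.comp (tendsto_atTop_mono hk heven)
  have hll : l = l' := (hcomplete (fun n => (w (2 * n)).2)
    fun i j k hij hjk => hinc _ _ _ (by omega) (by omega)).unique h1 (hl'.comp heven)
  subst hll
  obtain ⟨n, hn⟩ := ((hl'.comp hodd).eventually hU).exists
  exact (hQ (2 * n + 1)).2.2 (by simp) hn

theorem HasLeftLim.unique {C : Type*} {R : C → C → C → Prop} (hcomplete : IncreasingComplete R)
    {G : Set (ℝ × C)} (hG : CyclicMono R G) (hd : DenseFst G) {t : ℝ} {l l' : C}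
    (hl : HasLeftLim R G t l) (hl' : HasLeftLim R G t l') : l = l' := by
  obtain ⟨u, huG, humono, hulow, huup⟩ := exists_strictMono_fst (fun _ p => p ∈ G) t
    fun _ a ha => hd a t ha
  have key : ∀ m, HasLeftLim R G t m →
      Tendsto (fun n => (u n).2) atTop (@nhds C (intervalTopology R) m) := by
    intro m hm U hU
    obtain ⟨a, ha, h⟩ := hm U hU
    rw [Filter.mem_map]
    filter_upwards [eventually_lt_of_sub_one_div_lt hulow ha] with n hn
    exact h _ (huG n) hn (huup n)
  exact (hcomplete _ (hG.increasing huG humono hulow huup)).unique (key l hl) (key l' hl')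

theorem HasLeftLim.mono {C : Type*} {R : C → C → C → Prop} {G G' : Set (ℝ × C)} (h : G ⊆ G')
    {t : ℝ} {l : C} (hl : HasLeftLim R G' t l) : HasLeftLim R G t l := by
  intro U hU
  obtain ⟨a, ha, H⟩ := hl U hU
  exact ⟨a, ha, fun p hp => H p (h hp)⟩

theorem HasLeftLim.rel {C : Type*} {R : C → C → C → Prop}
    (hproper : ∀ a b c d : C, R a b c → R a b d → R a c d → R b c d →
      @closure C (intervalTopology R) {x | R b x c} ⊆ {x | R a x d})
    {G : Set (ℝ × C)} (hG : CyclicMono R G) (hd : DenseFst G) {t : ℝ} {l : C}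
    (hl : HasLeftLim R G t l) {p q : ℝ × C} (hp : p ∈ G) (hq : q ∈ G) (hpt : p.1 < t)
    (htq : t < q.1) (hqp : q.1 < p.1 + 1) : R p.2 l q.2 := by
  obtain ⟨b, hb, hpb, hbt⟩ := hd _ _ hpt
  obtain ⟨c, hc, htc, hcq⟩ := hd _ _ htq
  refine hproper p.2 b.2 c.2 q.2
    (hG _ hp _ hb _ hc hpb (by linarith) (by linarith))
    (hG _ hp _ hb _ hq hpb (by linarith) (by linarith))
    (hG _ hp _ hc _ hq (by linarith) hcq (by linarith))
    (hG _ hb _ hc _ hq (by linarith) hcq (by linarith)) ?_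
  let _ := intervalTopology R
  rw [mem_closure_iff_nhds]
  intro U hU
  obtain ⟨a, ha, H⟩ := hl U hU
  obtain ⟨r, hr, hrm, hrt⟩ := hd (max a b.1) t (max_lt ha hbt)
  have hbr : b.1 < r.1 := (le_max_right _ _).trans_lt hrm
  exact ⟨r.2, H r hr ((le_max_left _ _).trans_lt hrm) hrt,
    hG _ hb _ hr _ hc hbr (by linarith) (by linarith)⟩

theorem rel_of_separated {C : Type*} {R : C → C → C → Prop}
    (hcyc : ∀ a b c : C, R a b c → R b c a)
    (htrans : ∀ a b c d : C, R a b c → R a c d → R a b d)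
    {x y z p q r : C} (hx : R r x p) (hy : R p y q) (hz : R q z r) (hpqr : R p q r) :
    R x y z := by
  have h1 : R q z p := htrans _ _ _ _ hz (hcyc _ _ _ hpqr)
  have h2 : R p y z := htrans _ _ _ _ hy (hcyc _ _ _ (hcyc _ _ _ h1))
  have h3 : R r p z :=
    htrans _ _ _ _ (hcyc _ _ _ (hcyc _ _ _ hpqr)) (hcyc _ _ _ (hcyc _ _ _ hz))
  have h4 : R p z x := by
    have h5 : R p z r := hcyc _ _ _ h3
    exact htrans _ _ _ _ h5 (hcyc _ _ _ (hcyc _ _ _ hx))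
  have h6 : R z x p := hcyc _ _ _ h4
  have h7 : R z p y := hcyc _ _ _ (hcyc _ _ _ h2)
  exact hcyc _ _ _ (htrans _ _ _ _ h6 h7)

theorem CyclicMono.union_graph_leftLim {C : Type*} {R : C → C → C → Prop}
    (hcyc : ∀ a b c : C, R a b c → R b c a)
    (htrans : ∀ a b c d : C, R a b c → R a c d → R a b d)
    (hproper : ∀ a b c d : C, R a b c → R a b d → R a c d → R b c d →
      @closure C (intervalTopology R) {x | R b x c} ⊆ {x | R a x d})
    {G : Set (ℝ × C)} (hG : CyclicMono R G) (hd : DenseFst G)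
    (hper : ∀ p ∈ G, (p.1 + 1, p.2) ∈ G) {η : ℝ → C} (hη : ∀ t, HasLeftLim R G t (η t)) :
    CyclicMono R (G ∪ {p | p.2 = η p.1}) := by
  have key : ∀ x ∈ G ∪ {p | p.2 = η p.1}, ∀ p ∈ G, ∀ q ∈ G, p.1 < x.1 → x.1 < q.1 →
      q.1 < p.1 + 1 → R p.2 x.2 q.2 := by
    rintro x (hx | hx) p hp q hq hpx hxq hqp
    · exact hG _ hp _ hx _ hq hpx hxq hqp
    · rw [Set.mem_ofPred_eq] at hx
      rw [hx]
      exact (hη x.1).rel hproper hG hd hp hq hpx hxq hqp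
  intro x hx y hy z hz hxy hyz hzx
  obtain ⟨p, hp, hxp, hpy⟩ := hd _ _ hxy
  obtain ⟨q, hq, hyq, hqz⟩ := hd _ _ hyz
  obtain ⟨r, hr, hzr, hrx⟩ := hd (z.1 - 1) x.1 (by linarith)
  refine rel_of_separated hcyc htrans (key x hx r hr p hp hrx hxp (by linarith))
    (key y hy p hp q hq hpy hyq (by linarith))
    (key z hz q hq (r.1 + 1, r.2) (hper r hr) hqz (by linarith) (by linarith))
    (hG _ hp _ hq (r.1 + 1, r.2) (hper r hr) (by linarith) (by linarith) (by linarith))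

theorem continuous_of_automorphism {C : Type*} {R : C → C → C → Prop} (e : Equiv.Perm C)
    (h : ∀ a b c, R a b c → R (e a) (e b) (e c))
    (h' : ∀ a b c, R a b c → R (e.symm a) (e.symm b) (e.symm c)) :
    @Continuous C C (intervalTopology R) (intervalTopology R) e := by
  let _ := intervalTopology R
  refine continuous_generateFrom_iff.2 ?_
  rintro _ ⟨p, q, rfl⟩
  refine TopologicalSpace.isOpen_generateFrom_of_mem ⟨e.symm p, e.symm q, ?_⟩
  ext x
  constructor
  · intro hx
    simpa using h' _ _ _ hx
  · intro hx
    simpa using h _ _ _ hx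

theorem coe_eq_coe_iff_exists_int {a b : ℝ} :
    (a : AddCircle (1 : ℝ)) = b ↔ ∃ m : ℤ, a = b + m := by
  rw [← sub_eq_zero, ← AddCircle.coe_sub, AddCircle.coe_eq_zero_iff]
  constructor
  · rintro ⟨m, hm⟩
    exact ⟨m, by simp at hm; linarith⟩
  · rintro ⟨m, hm⟩
    exact ⟨m, by simp; linarith⟩

theorem eq_of_coe_eq_coe {a b c : ℝ} (h : (a : AddCircle (1 : ℝ)) = b) (hca : c < a)
    (hac : a < c + 1) (hcb : c < b) (hbc : b < c + 1) : a = b := by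
  obtain ⟨m, rfl⟩ := coe_eq_coe_iff_exists_int.1 h
  have h1 : (m : ℝ) < 1 := by linarith
  have h2 : (-1 : ℝ) < m := by linarith
  have h3 : m < 1 := by exact_mod_cast h1
  have h4 : -1 < m := by exact_mod_cast h2
  have : m = 0 := by omega
  simp [this]

theorem cycS1_coe {a b c : ℝ} (hab : a < b) (hbc : b < c) (hca : c < a + 1) :
    cycS1 a b c :=
  ⟨a, b, c, rfl, rfl, rfl, hab, hbc, hca⟩

theorem cycS1.exists_lift_right {x y z : AddCircle (1 : ℝ)} (h : cycS1 x y z) {t : ℝ}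
    (ht : (t : AddCircle (1 : ℝ)) = z) :
    ∃ a b : ℝ, (a : AddCircle (1 : ℝ)) = x ∧ (b : AddCircle (1 : ℝ)) = y ∧
      a < b ∧ b < t ∧ t < a + 1 := by
  obtain ⟨a, b, c, rfl, rfl, rfl, hab, hbc, hca⟩ := h
  obtain ⟨m, rfl⟩ := coe_eq_coe_iff_exists_int.1 ht
  exact ⟨a + m, b + m, coe_eq_coe_iff_exists_int.2 ⟨m, rfl⟩,
    coe_eq_coe_iff_exists_int.2 ⟨m, rfl⟩, by linarith, by linarith, by linarith⟩

theorem ConvLeft.exists_lift {s : ℕ → AddCircle (1 : ℝ)} {t : ℝ}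
    (h : ConvLeft s (t : AddCircle (1 : ℝ))) :
    ∃ r : ℕ → ℝ, (∀ n, (r n : AddCircle (1 : ℝ)) = s n) ∧ Tendsto r atTop (𝓝 t) ∧
      ∀ᶠ n in atTop, r n < t := by
  obtain ⟨hs, z, hz⟩ := h
  have : Fact ((0 : ℝ) < 1) := ⟨one_pos⟩
  have ht : t ∈ Set.Ioo (t - 1 / 2) (t - 1 / 2 + 1) := by constructor <;> linarith
  have hne : (t : AddCircle (1 : ℝ)) ≠ ((t - 1 / 2 : ℝ) : AddCircle (1 : ℝ)) := by
    intro heq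
    have := eq_of_coe_eq_coe (c := t - 3 / 4) heq (by linarith) (by linarith) (by linarith)
      (by linarith)
    linarith
  have hcont := AddCircle.continuousAt_equivIco (1 : ℝ) (t - 1 / 2) hne
  have hr : ∀ x, (((AddCircle.equivIco (1 : ℝ) (t - 1 / 2) x : ℝ)) : AddCircle (1 : ℝ)) = x :=
    fun x => (AddCircle.equivIco (1 : ℝ) (t - 1 / 2)).symm_apply_apply x
  have hval : (AddCircle.equivIco (1 : ℝ) (t - 1 / 2) t : ℝ) = t := by
    rw [AddCircle.equivIco_coe_eq (Set.Ioo_subset_Ico_self ht)]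
  have hlim : Tendsto (fun n => (AddCircle.equivIco (1 : ℝ) (t - 1 / 2) (s n) : ℝ)) atTop
      (𝓝 t) := by
    have := (continuous_subtype_val.continuousAt.comp hcont).tendsto.comp hs
    simpa [Function.comp_def, hval] using this
  refine ⟨_, fun n => hr (s n), hlim, ?_⟩
  obtain ⟨N, hN⟩ := hz.exists
  obtain ⟨a, b, rfl, -, hab, hbt, hta⟩ := hN.exists_lift_right rfl
  filter_upwards [hz, hlim.eventually (Ioo_mem_nhds (hab.trans hbt) hta)] with n hn hrn
  obtain ⟨a', b', haa', hb', hab', hbt', hta'⟩ := hn.exists_lift_right rfl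
  have haa : a' = a := eq_of_coe_eq_coe (c := t - 1) haa' (by linarith) (by linarith)
    (by linarith) (by linarith)
  subst haa
  have := eq_of_coe_eq_coe (c := a') ((hr (s n)).trans hb'.symm) hrn.1 hrn.2 hab' (by linarith)
  rw [this]
  exact hbt'

theorem HasLeftLim.tendsto_of_convLeft {C : Type*} {R : C → C → C → Prop} {G : Set (ℝ × C)}
    {t : ℝ} {l : C} (hl : HasLeftLim R G t l) {s : ℕ → AddCircle (1 : ℝ)} {f : AddCircle (1 : ℝ) → C}
    (hs : ConvLeft s t)
    (hf : ∀ n, ∀ r : ℝ, (r : AddCircle (1 : ℝ)) = s n → (r, f (s n)) ∈ G) :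
    Tendsto (fun n => f (s n)) atTop (@nhds C (intervalTopology R) l) := by
  obtain ⟨r, hr, hlim, hlt⟩ := hs.exists_lift
  intro U hU
  obtain ⟨a, ha, H⟩ := hl U hU
  rw [Filter.mem_map]
  filter_upwards [hlt, hlim.eventually (lt_mem_nhds ha)] with n h1 h2
  exact H _ (hf n (r n) (hr n)) h2 h1

/-- The graph of `f` restricted to `D`, lifted to the universal cover of the circle. -/
def liftedGraph {C : Type*} (D : Set (AddCircle (1 : ℝ))) (f : AddCircle (1 : ℝ) → C) :
    Set (ℝ × C) :=
  {p | (p.1 : AddCircle (1 : ℝ)) ∈ D ∧ p.2 = f p.1}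

theorem cyclicMono_liftedGraph {C : Type*} {R : C → C → C → Prop} {D : Set (AddCircle (1 : ℝ))}
    {f : AddCircle (1 : ℝ) → C}
    (hf : ∀ x ∈ D, ∀ y ∈ D, ∀ z ∈ D, cycS1 x y z → R (f x) (f y) (f z)) :
    CyclicMono R (liftedGraph D f) := by
  intro p ⟨ha, hp⟩ q ⟨hb, hq⟩ r ⟨hc, hr⟩ hab hbc hca
  rw [hp, hq, hr]
  exact hf _ ha _ hb _ hc (cycS1_coe hab hbc hca)

theorem denseFst_liftedGraph {C : Type*} {D : Set (AddCircle (1 : ℝ))} (hD : Dense D)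
    (f : AddCircle (1 : ℝ) → C) : DenseFst (liftedGraph D f) := by
  intro a b hab
  have hd : Dense ((fun r : ℝ => (r : AddCircle (1 : ℝ))) ⁻¹' D) :=
    hD.preimage QuotientAddGroup.isOpenMap_coe
  obtain ⟨r, hr, har, hrb⟩ := hd.exists_between hab
  exact ⟨(r, f r), ⟨hr, rfl⟩, har, hrb⟩

theorem hasLeftLim_liftedGraph_congr {C : Type*} {R : C → C → C → Prop}
    {D : Set (AddCircle (1 : ℝ))} {f : AddCircle (1 : ℝ) → C} {t t' : ℝ} {l : C}
    (h : (t : AddCircle (1 : ℝ)) = t') (hl : HasLeftLim R (liftedGraph D f) t l) :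
    HasLeftLim R (liftedGraph D f) t' l := by
  obtain ⟨m, rfl⟩ := coe_eq_coe_iff_exists_int.1 h
  intro U hU
  obtain ⟨a, ha, H⟩ := hl U hU
  refine ⟨a - m, by linarith, ?_⟩
  rintro ⟨r, y⟩ ⟨hr, hy⟩ har hrt
  simp only at hy
  subst hy
  have hrm : ((r + m : ℝ) : AddCircle (1 : ℝ)) = r := coe_eq_coe_iff_exists_int.2 ⟨m, rfl⟩
  simp only at har hrt hr ⊢
  have := H (r + m, f ((r + m : ℝ) : AddCircle (1 : ℝ)))
    ⟨by simpa only [hrm] using hr, rfl⟩ (by simp only; linarith) (by simp only; linarith)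
  rwa [hrm] at this

theorem HasLeftLim.map_equivariant {C : Type*} {R : C → C → C → Prop}
    {D : Set (AddCircle (1 : ℝ))} {f : AddCircle (1 : ℝ) → C}
    {g : Equiv.Perm (AddCircle (1 : ℝ))} {e : Equiv.Perm C}
    (hg : ∀ x y z, cycS1 x y z → cycS1 (g.symm x) (g.symm y) (g.symm z))
    (hgD : ∀ x ∈ D, g.symm x ∈ D)
    (he : @Continuous C C (intervalTopology R) (intervalTopology R) e)
    (hf : ∀ x ∈ D, f (g x) = e (f x)) {t t' : ℝ} (htt' : g t = t') {l : C}
    (hl : HasLeftLim R (liftedGraph D f) t l) :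
    HasLeftLim R (liftedGraph D f) t' (e l) := by
  intro U hU
  obtain ⟨a₀, ha₀, H₀⟩ := hl (e ⁻¹' U)
    (@Continuous.tendsto C C (intervalTopology R) (intervalTopology R) e he l U hU)
  obtain ⟨a, ha, hat, H⟩ : ∃ a, t - 1 < a ∧ a < t ∧
      ∀ p ∈ liftedGraph D f, a < p.1 → p.1 < t → e p.2 ∈ U := by
    refine ⟨max a₀ (t - 1 / 2), lt_max_of_lt_right (by linarith),
      max_lt ha₀ (by linarith), fun p hp hap hpt => ?_⟩
    exact H₀ p hp ((le_max_left _ _).trans_lt hap) hpt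
  have : Fact ((0 : ℝ) < 1) := ⟨one_pos⟩
  obtain ⟨a', ⟨ha't, ha't'⟩, haa'⟩ : ∃ a' ∈ Set.Ico (t' - 1) t', (a' : AddCircle (1 : ℝ)) = g a := by
    have hmem := (AddCircle.equivIco (1 : ℝ) (t' - 1) (g a)).2
    exact ⟨_, ⟨hmem.1, hmem.2.trans_eq (by ring)⟩, (AddCircle.equivIco (1 : ℝ) (t' - 1)).symm_apply_apply (g a)⟩
  have hne : t' - 1 ≠ a' := by
    rintro rfl
    have h1 : g a = g t := by
      rw [← haa', htt']
      exact coe_eq_coe_iff_exists_int.2 ⟨-1, by push_cast; ring⟩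
    have := eq_of_coe_eq_coe (c := (t - 1 + a) / 2) (g.injective h1) (by linarith) (by linarith)
      (by linarith) (by linarith)
    linarith
  refine ⟨a', ha't', ?_⟩
  rintro ⟨r, y⟩ ⟨hr, hy⟩ har hrt
  simp only at hy
  subst hy
  have hlt := lt_of_le_of_ne ha't hne
  have hc := hg _ _ _ (cycS1_coe har hrt (by linarith))
  rw [haa', ← htt', Equiv.symm_apply_apply, Equiv.symm_apply_apply] at hc
  obtain ⟨b, r', hb, hr', hbr, hrt', htb⟩ := hc.exists_lift_right rfl
  have hba : b = a := eq_of_coe_eq_coe (c := t - 1) hb (by linarith) (by linarith)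
    (by linarith) (by linarith)
  subst hba
  have hrD : (r' : AddCircle (1 : ℝ)) ∈ D := hr' ▸ hgD _ hr
  have := H (r', f r') ⟨hrD, rfl⟩ hbr hrt'
  simp only at this ⊢
  rwa [← hf _ hrD, hr', Equiv.apply_symm_apply] at this

/-- existence of the boundary map for generalized Schottky groups.  Let `C` be
a partially cyclically ordered set which is first countable, increasing-complete, full and
proper; let `D ⊆ S¹` be dense and invariant under a group `Γ` acting on `S¹` by
cyclic-order-preserving bijections and on `C` by automorphisms of the partial cyclic order,
and let `ξ₀ : D → C` be increasing and equivariant.  Then there is an increasing,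
equivariant, left-continuous map `ξ : S¹ → C` such that `ξ₀(x_n) → ξ(x)` for every
increasing sequence `x_n ∈ D` converging to `x` from the left. -/
theorem boundary_map_of_schottky {C : Type*} (R : C → C → C → Prop)
    (hcyc : ∀ a b c : C, R a b c → R b c a)
    (hasym : ∀ a b c : C, R a b c → ¬ R c b a)
    (htrans : ∀ a b c d : C, R a b c → R a c d → R a b d)
    (hfc : @FirstCountableTopology C (intervalTopology R))
    (hcomplete : ∀ s : ℕ → C, (∀ i j k : ℕ, i < j → j < k → R (s i) (s j) (s k)) →
      ∃! l : C, Filter.Tendsto s Filter.atTop (@nhds C (intervalTopology R) l))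
    (hfull : ∀ a b : C, (∃ x, R a x b) → ∃ x, R b x a)
    (hproper : ∀ a b c d : C, R a b c → R a b d → R a c d → R b c d →
      @closure C (intervalTopology R) {x | R b x c} ⊆ {x | R a x d})
    (D : Set (AddCircle (1 : ℝ))) (hD : Dense D)
    (Γ : Type*) [Group Γ]
    (φ : Γ →* Equiv.Perm (AddCircle (1 : ℝ)))
    (hφ : ∀ (γ : Γ) (x y z : AddCircle (1 : ℝ)), cycS1 x y z → cycS1 (φ γ x) (φ γ y) (φ γ z))
    (hφD : ∀ γ : Γ, ⇑(φ γ) '' D = D)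
    (ψ : Γ →* Equiv.Perm C)
    (hψ : ∀ (γ : Γ) (a b c : C), R a b c → R (ψ γ a) (ψ γ b) (ψ γ c))
    (ξ₀ : AddCircle (1 : ℝ) → C)
    (hξ₀inc : ∀ x ∈ D, ∀ y ∈ D, ∀ z ∈ D, cycS1 x y z → R (ξ₀ x) (ξ₀ y) (ξ₀ z))
    (hξ₀eq : ∀ (γ : Γ), ∀ x ∈ D, ξ₀ (φ γ x) = ψ γ (ξ₀ x)) :
    ∃ ξ : AddCircle (1 : ℝ) → C,
      (∀ x y z : AddCircle (1 : ℝ), cycS1 x y z → R (ξ x) (ξ y) (ξ z)) ∧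
      (∀ (γ : Γ) (x : AddCircle (1 : ℝ)), ξ (φ γ x) = ψ γ (ξ x)) ∧
      (∀ (x : AddCircle (1 : ℝ)) (s : ℕ → AddCircle (1 : ℝ)), ConvLeft s x →
        Filter.Tendsto (fun n => ξ (s n)) Filter.atTop (@nhds C (intervalTopology R) (ξ x))) ∧
      (∀ (x : AddCircle (1 : ℝ)) (s : ℕ → AddCircle (1 : ℝ)), (∀ n, s n ∈ D) →
        (∀ i j k : ℕ, i < j → j < k → cycS1 (s i) (s j) (s k)) → ConvLeft s x →
        Filter.Tendsto (fun n => ξ₀ (s n)) Filter.atTop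
          (@nhds C (intervalTopology R) (ξ x))) := by
  have hG := cyclicMono_liftedGraph hξ₀inc
  have hd := denseFst_liftedGraph hD ξ₀
  choose η hη using exists_hasLeftLim hcomplete hG hd
  have hsurj : ∀ x : AddCircle (1 : ℝ), ∃ t : ℝ, (t : AddCircle (1 : ℝ)) = x :=
    QuotientAddGroup.mk_surjective
  choose lift hlift using hsurj
  let ξ : AddCircle (1 : ℝ) → C := fun x => η (lift x)
  have hξ : ∀ t : ℝ, HasLeftLim R (liftedGraph D ξ₀) t (ξ t) := fun t =>
    hasLeftLim_liftedGraph_congr (hlift t) (hη _)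
  have hper : ∀ p ∈ liftedGraph D ξ₀, (p.1 + 1, p.2) ∈ liftedGraph D ξ₀ := by
    rintro ⟨r, y⟩ ⟨hr, hy⟩
    simp only at hy
    subst hy
    have : ((r + 1 : ℝ) : AddCircle (1 : ℝ)) = r :=
      coe_eq_coe_iff_exists_int.2 ⟨1, by simp⟩
    exact ⟨by simpa only [this] using hr, by simp only [this]⟩
  have hG₁ := hG.union_graph_leftLim hcyc htrans hproper hd hper hξ
  have hξ₁ : ∀ t : ℝ, HasLeftLim R
      (liftedGraph D ξ₀ ∪ {p : ℝ × C | p.2 = ξ p.1}) t (ξ t) := by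
    intro t
    obtain ⟨l, hl⟩ := exists_hasLeftLim hcomplete hG₁ (fun a b hab =>
      let ⟨p, hp, h⟩ := hd a b hab; ⟨p, Or.inl hp, h⟩) t
    rwa [(hξ t).unique hcomplete hG hd (hl.mono Set.subset_union_left)]
  refine ⟨ξ, ?_, ?_, ?_, ?_⟩
  · rintro x y z ⟨a, b, c, rfl, rfl, rfl, hab, hbc, hca⟩
    exact hG₁ (a, ξ a) (Or.inr rfl) (b, ξ b) (Or.inr rfl) (c, ξ c) (Or.inr rfl) hab hbc hca
  · intro γ x
    have hφsymm : (φ γ).symm = φ γ⁻¹ := by rw [map_inv]; rfl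
    have hψsymm : (ψ γ).symm = ψ γ⁻¹ := by rw [map_inv]; rfl
    have hlim : HasLeftLim R (liftedGraph D ξ₀) (lift (φ γ x)) (ψ γ (ξ x)) := by
      refine HasLeftLim.map_equivariant (g := φ γ) (t := lift x) ?_ ?_ ?_ (hξ₀eq γ) ?_ (hη _)
      · rw [hφsymm]
        exact hφ γ⁻¹
      · intro y hy
        rw [hφsymm, ← hφD γ⁻¹]
        exact Set.mem_image_of_mem _ hy
      · exact continuous_of_automorphism _ (hψ γ) (hψsymm ▸ hψ γ⁻¹)
      · rw [hlift, hlift]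
    exact (hη _).unique hcomplete hG hd hlim
  · intro x s hs
    obtain ⟨t, rfl⟩ : ∃ t : ℝ, (t : AddCircle (1 : ℝ)) = x := ⟨lift x, hlift x⟩
    exact (hξ₁ t).tendsto_of_convLeft hs fun n r hr => Or.inr (by simp [hr])
  · intro x s hsD _ hs
    obtain ⟨t, rfl⟩ : ∃ t : ℝ, (t : AddCircle (1 : ℝ)) = x := ⟨lift x, hlift x⟩
    exact (hξ t).tendsto_of_convLeft hs fun n r hr =>
      ⟨by simpa only [hr] using hsD n, by simp only [hr]⟩
end

section
/- Let C be a full partially cyclically ordered set and a,b ∈ C with the interval (a,b) nonempty. Then there exists a countably infinite subset X ⊆ (a,b) such that X is a cycle (the partial cyclic order restricts to a total cyclic order on X, i.e. any three distinct elements of X are related by ⟨·,·,·⟩ in some order) and such that for every pair of distinct elements x_1,x_2 ∈ X the intersection (x_1,x_2) ∩ X is nonempty. -/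
/-- A maximal chain in a densely ordered partial order is densely ordered. -/
theorem Flag.denselyOrdered {α : Type*} [PartialOrder α] [DenselyOrdered α] (s : Flag α) :
    DenselyOrdered s := by
  refine ⟨fun ⟨p, hp⟩ ⟨q, hq⟩ hpq => ?_⟩
  replace hpq : p < q := hpq
  by_contra! hgap
  obtain ⟨z, hpz, hzq⟩ := exists_between hpq
  have hchain : IsChain (· ≤ ·) (insert z (s : Set α)) := by
    refine s.chain_le.insert fun r hr _ => ?_
    rcases s.le_or_le hr hp with hrp | hpr
    · exact Or.inr (hrp.trans hpz.le)
    rcases s.le_or_le hr hq with hrq | hqr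
    · rcases hpr.eq_or_lt with rfl | hpr
      · exact Or.inr hpz.le
      rcases hrq.eq_or_lt with rfl | hrq
      · exact Or.inl hzq.le
      exact absurd hrq (hgap ⟨r, hr⟩ hpr)
    · exact Or.inl (hzq.le.trans hqr)
  have hz : z ∈ s := by
    have hins := s.maxChain.2 hchain (Set.subset_insert z _)
    have hmem : z ∈ (s : Set α) := hins ▸ Set.mem_insert z _
    exact hmem
  exact hgap ⟨z, hz⟩ hpz hzq

/-- A densely ordered partial order with two comparable elements contains a copy of `ℚ`. -/
theorem exists_strictMono_rat_of_lt {α : Type*} [PartialOrder α] [DenselyOrdered α] {x y : α}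
    (hxy : x < y) : ∃ f : ℚ → α, StrictMono f := by
  classical
  obtain ⟨s, hx, hy⟩ := Flag.exists_mem_mem hxy.le
  have : DenselyOrdered s := s.denselyOrdered
  have : Nontrivial s := ⟨⟨⟨x, hx⟩, ⟨y, hy⟩, fun h => hxy.ne (congrArg Subtype.val h)⟩⟩
  obtain ⟨f⟩ := Order.embedding_from_countable_to_dense ℚ s
  exact ⟨fun q => f q, fun _ _ h => f.strictMono h⟩


/-- in a full partially cyclically ordered set, any nonempty interval `(a,b)`
contains a countably infinite subset `X` which is a cycle (the PCO restricts to a total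
cyclic order on `X`) and such that between any two distinct points of `X` there is another
point of `X`. -/
theorem full_interval_contains_dense_cycle {C : Type*} (R : C → C → C → Prop)
    (hcyc : ∀ a b c : C, R a b c → R b c a)
    (hasym : ∀ a b c : C, R a b c → ¬ R c b a)
    (htrans : ∀ a b c d : C, R a b c → R a c d → R a b d)
    (hfull : ∀ a b : C, (∃ x, R a x b) → ∃ x, R b x a)
    (a b : C) (hne : ∃ x, R a x b) :
    ∃ X : Set C, X ⊆ {x | R a x b} ∧ X.Countable ∧ X.Infinite ∧
      (∀ x ∈ X, ∀ y ∈ X, ∀ z ∈ X, x ≠ y → y ≠ z → x ≠ z → R x y z ∨ R z y x) ∧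
      (∀ x₁ ∈ X, ∀ x₂ ∈ X, x₁ ≠ x₂ → ∃ w ∈ X, R x₁ w x₂) := by
  have hdense : ∀ x y : C, R a x y → ∃ z, R a x z ∧ R a z y := fun x y h => by
    obtain ⟨z, hz⟩ := hfull y x ⟨a, hcyc _ _ _ (hcyc _ _ _ h)⟩
    exact ⟨z, hcyc _ _ _ (hcyc _ _ _ (htrans _ _ _ _ hz (hcyc _ _ _ h))),
      hcyc _ _ _ (htrans _ _ _ _ (hcyc _ _ _ (hcyc _ _ _ h)) (hcyc _ _ _ (hcyc _ _ _ hz)))⟩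
  have hrot : ∀ x y z : C, R a x y → R a y z → R x y z := fun x y z hxy hyz =>
    hcyc _ _ _ (hcyc _ _ _ (htrans _ _ _ _ (hcyc _ _ _ hyz) (hcyc _ _ _ (hcyc _ _ _ hxy))))
  let S : {c // R a c b} → {c // R a c b} → Prop := fun x y => R a x y
  have hS : IsStrictOrder _ S :=
    { irrefl := fun x h => hasym _ _ _ h (hcyc _ _ _ h)
      trans := fun x y z hxy hyz => htrans _ _ _ _ hxy hyz }
  let _ : PartialOrder {c // R a c b} := partialOrderOfSO S
  have : DenselyOrdered {c // R a c b} := ⟨fun x y h => by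
    obtain ⟨z, hxz, hzy⟩ := hdense x y h
    exact ⟨⟨z, htrans _ _ _ _ hzy y.2⟩, hxz, hzy⟩⟩
  obtain ⟨x, hx⟩ := hne
  obtain ⟨y, hxy, hy⟩ := hdense x b hx
  obtain ⟨f, hf⟩ := exists_strictMono_rat_of_lt
    (show (⟨x, hx⟩ : {c // R a c b}) < ⟨y, hy⟩ from hxy)
  have hlt : ∀ {p q : ℚ}, p < q → R a (f p) (f q) := fun h => hf h
  have hcycle : ∀ {p q r : ℚ}, p < q → q < r → R (f p) (f q) (f r) :=
    fun hpq hqr => hrot _ _ _ (hlt hpq) (hlt hqr)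
  refine ⟨Set.range fun q => (f q : C), ?_, Set.countable_range _,
    Set.infinite_range_of_injective (Subtype.val_injective.comp hf.injective), ?_, ?_⟩
  · rintro _ ⟨q, rfl⟩
    exact (f q).2
  · rintro _ ⟨p, rfl⟩ _ ⟨q, rfl⟩ _ ⟨r, rfl⟩ hpq hqr hpr
    have hpq' : p ≠ q := fun h => hpq (h ▸ rfl)
    have hqr' : q ≠ r := fun h => hqr (h ▸ rfl)
    have hpr' : p ≠ r := fun h => hpr (h ▸ rfl)
    rcases hpq'.lt_or_gt with h₁ | h₁ <;> rcases hqr'.lt_or_gt with h₂ | h₂ <;>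
      rcases hpr'.lt_or_gt with h₃ | h₃
    · exact Or.inl (hcycle h₁ h₂)
    · exact absurd (h₁.trans h₂) h₃.not_gt
    · exact Or.inr (hcyc _ _ _ (hcycle h₃ h₂))
    · exact Or.inl (hcyc _ _ _ (hcycle h₃ h₁))
    · exact Or.inr (hcyc _ _ _ (hcyc _ _ _ (hcycle h₁ h₃)))
    · exact Or.inl (hcyc _ _ _ (hcyc _ _ _ (hcycle h₂ h₃)))
    · exact absurd (h₂.trans h₁) h₃.not_gt
    · exact Or.inr (hcycle h₂ h₁)
  · rintro _ ⟨p, rfl⟩ _ ⟨q, rfl⟩ hne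
    have hpq : p ≠ q := fun h => hne (h ▸ rfl)
    rcases hpq.lt_or_gt with h | h
    · obtain ⟨r, hpr, hrq⟩ := exists_between h
      exact ⟨_, ⟨r, rfl⟩, hcycle hpr hrq⟩
    · obtain ⟨r, hpr⟩ := exists_gt p
      exact ⟨_, ⟨r, rfl⟩, hcyc _ _ _ (hcycle h hpr)⟩
end

section
/- Let V be a real vector space of dimension 2n (n ≥ 1) with a nondegenerate alternating bilinear form ω. For Lagrangian subspaces P,Q,R of V define ⟨P,Q,R⟩ to mean: P and R are transverse and B_{P,R}(q,q) > 0 for every nonzero q ∈ Q. Then this relation is a partial cyclic order on the set of Lagrangians, invariant under the symplectic group: (cyclicity) ⟨P,Q,R⟩ implies ⟨Q,R,P⟩; (asymmetry) ⟨P,Q,R⟩ implies not ⟨R,Q,P⟩; (transitivity) ⟨P,Q,R⟩ and ⟨P,R,S⟩ imply ⟨P,Q,S⟩; and for every g ∈ Sp(V,ω), ⟨P,Q,R⟩ holds if and only if ⟨gP,gQ,gR⟩ holds. -/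
open Module

/-- A Lagrangian subspace: an `n`-dimensional subspace on which `ω` vanishes identically. -/
def IsLagrangian {V : Type*} [AddCommGroup V] [Module ℝ V]
    (ω : LinearMap.BilinForm ℝ V) (n : ℕ) (L : Submodule ℝ V) : Prop :=
  finrank ℝ L = n ∧ ∀ v ∈ L, ∀ w ∈ L, ω v w = 0

/-- The relation `⟨P,Q,R⟩` on Lagrangians: `P` and `R` are transverse and the form
`B_{P,R}(v,w) = ω(v, Inv_{P,R} w)` is positive on nonzero vectors of `Q`, where `Inv_{P,R}`
is the reflection in the pair `(P,R)` (the involution equal to `-id` on `P` and `+id` on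
`R`).  This is equivalent to the generalized Maslov index `M(P,Q,R)` being maximal. -/
def MaslovMax {V : Type*} [AddCommGroup V] [Module ℝ V]
    (ω : LinearMap.BilinForm ℝ V) (P Q R : Submodule ℝ V) : Prop :=
  P ⊓ R = ⊥ ∧ ∃ Inv : V →ₗ[ℝ] V, (∀ v ∈ P, Inv v = -v) ∧ (∀ v ∈ R, Inv v = v) ∧
    ∀ q ∈ Q, q ≠ 0 → 0 < ω q (Inv q)

section MaslovMax

variable {V : Type*} [AddCommGroup V] [Module ℝ V] {ω : LinearMap.BilinForm ℝ V}

/-- On isotropic subspaces `P` and `R`, the form `B_{P,R}` at `p + r` equals `2 ω(p,r)`. -/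
theorem reflection_form_add (halt : ω.IsAlt) {P R : Submodule ℝ V} {Inv : V →ₗ[ℝ] V}
    (hInvP : ∀ v ∈ P, Inv v = -v) (hInvR : ∀ v ∈ R, Inv v = v)
    {p r : V} (hp : p ∈ P) (hr : r ∈ R) :
    ω (p + r) (Inv (p + r)) = 2 * ω p r := by
  have h : -ω p r = ω r p := halt.neg_eq p r
  have hpp : ω p p = 0 := halt p
  have hrr : ω r r = 0 := halt r
  rw [map_add Inv, hInvP p hp, hInvR r hr]
  simp only [map_add, map_neg, LinearMap.add_apply, hpp, hrr]
  linarith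

theorem IsLagrangian.isCompl [FiniteDimensional ℝ V] {n : ℕ} (hdim : finrank ℝ V = 2 * n)
    {P R : Submodule ℝ V} (hP : IsLagrangian ω n P) (hR : IsLagrangian ω n R)
    (h : P ⊓ R = ⊥) : IsCompl P R := by
  refine (Submodule.isCompl_iff_disjoint P R ?_).2 (disjoint_iff.2 h)
  rw [hdim, hP.1, hR.1, two_mul]

/-- Reflection-free form of `MaslovMax`: writing elements of `Q` as `p + r` with `p ∈ P` and
`r ∈ R`, the number `ω(p,r)` is positive. -/
theorem maslovMax_iff_of_isLagrangian [FiniteDimensional ℝ V] {n : ℕ}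
    (hdim : finrank ℝ V = 2 * n) (halt : ω.IsAlt) {P Q R : Submodule ℝ V}
    (hP : IsLagrangian ω n P) (hR : IsLagrangian ω n R) :
    MaslovMax ω P Q R ↔
      P ⊓ R = ⊥ ∧ ∀ p ∈ P, ∀ r ∈ R, p + r ∈ Q → p + r ≠ 0 → 0 < ω p r := by
  constructor
  · rintro ⟨hPR, Inv, hInvP, hInvR, hpos⟩
    refine ⟨hPR, fun p hp r hr hq hne => ?_⟩
    have h := hpos _ hq hne
    rw [reflection_form_add halt hInvP hInvR hp hr] at h
    linarith
  · rintro ⟨hPR, hpos⟩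
    have hc := hP.isCompl hdim hR hPR
    have hInvP : ∀ v ∈ P, LinearMap.ofIsCompl hc (-P.subtype) R.subtype v = -v :=
      fun v hv => LinearMap.ofIsCompl_apply_left hc ⟨v, hv⟩
    have hInvR : ∀ v ∈ R, LinearMap.ofIsCompl hc (-P.subtype) R.subtype v = v :=
      fun v hv => LinearMap.ofIsCompl_apply_right hc ⟨v, hv⟩
    refine ⟨hPR, _, hInvP, hInvR, fun q hq hne => ?_⟩
    obtain ⟨p, hp, r, hr, rfl⟩ :=
      Submodule.mem_sup.1 (hc.sup_eq_top ▸ Submodule.mem_top : q ∈ P ⊔ R)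
    rw [reflection_form_add halt hInvP hInvR hp hr]
    linarith [hpos p hp r hr hq hne]

theorem MaslovMax.cyclic [FiniteDimensional ℝ V] {n : ℕ}
    (hdim : finrank ℝ V = 2 * n) (halt : ω.IsAlt) {P Q R : Submodule ℝ V}
    (hP : IsLagrangian ω n P) (hQ : IsLagrangian ω n Q) (hR : IsLagrangian ω n R)
    (h : MaslovMax ω P Q R) : MaslovMax ω Q R P := by
  rw [maslovMax_iff_of_isLagrangian hdim halt hP hR] at h
  obtain ⟨hPR, hpos⟩ := h
  rw [maslovMax_iff_of_isLagrangian hdim halt hQ hP]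
  refine ⟨(Submodule.eq_bot_iff _).2 fun x hx => ?_, fun q hq p hp hqp hne => ?_⟩
  · by_contra hx0
    have h := hpos x hx.2 0 R.zero_mem (by simpa using hx.1) (by simpa using hx0)
    simp at h
  · have hq_eq : -p + (q + p) = q := by abel
    have hq0 : q ≠ 0 := by
      rintro rfl
      rw [zero_add] at hqp hne
      exact hne ((Submodule.eq_bot_iff _).1 hPR p ⟨hp, hqp⟩)
    have h := hpos (-p) (P.neg_mem hp) (q + p) hqp (by rwa [hq_eq]) (by rwa [hq_eq])
    have hpp : ω p p = 0 := halt p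
    have hpq : -ω p q = ω q p := halt.neg_eq p q
    simp only [map_add, map_neg, LinearMap.neg_apply, hpp] at h
    linarith

theorem MaslovMax.not_reverse [FiniteDimensional ℝ V] {n : ℕ} (hn : 1 ≤ n)
    (hdim : finrank ℝ V = 2 * n) (halt : ω.IsAlt) {P Q R : Submodule ℝ V}
    (hP : IsLagrangian ω n P) (hQ : IsLagrangian ω n Q) (hR : IsLagrangian ω n R)
    (h : MaslovMax ω P Q R) : ¬ MaslovMax ω R Q P := by
  rw [maslovMax_iff_of_isLagrangian hdim halt hP hR] at h
  rw [maslovMax_iff_of_isLagrangian hdim halt hR hP]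
  rintro ⟨-, hneg⟩
  have hQ0 : Q ≠ ⊥ := by
    rintro rfl
    have h0 := hQ.1
    rw [finrank_bot] at h0
    omega
  obtain ⟨q, hq, hne⟩ := Q.exists_mem_ne_zero_of_ne_bot hQ0
  obtain ⟨p, hp, r, hr, rfl⟩ :=
    Submodule.mem_sup.1 ((hP.isCompl hdim hR h.1).sup_eq_top ▸ Submodule.mem_top : q ∈ P ⊔ R)
  have hpr := h.2 p hp r hr hq hne
  have hrp := hneg r hr p hp (by rwa [add_comm]) (by rwa [add_comm])
  have hanti : -ω p r = ω r p := halt.neg_eq p r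
  linarith

theorem MaslovMax.trans [FiniteDimensional ℝ V] {n : ℕ}
    (hdim : finrank ℝ V = 2 * n) (halt : ω.IsAlt) {P Q R S : Submodule ℝ V}
    (hP : IsLagrangian ω n P) (hR : IsLagrangian ω n R) (hS : IsLagrangian ω n S)
    (hPQR : MaslovMax ω P Q R) (hPRS : MaslovMax ω P R S) : MaslovMax ω P Q S := by
  rw [maslovMax_iff_of_isLagrangian hdim halt hP hR] at hPQR
  rw [maslovMax_iff_of_isLagrangian hdim halt hP hS] at hPRS ⊢
  refine ⟨hPRS.1, fun p hp s hs hq hne => ?_⟩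
  obtain ⟨p₁, hp₁, r, hr, hsum⟩ := Submodule.mem_sup.1
    ((hP.isCompl hdim hR hPQR.1).sup_eq_top ▸ Submodule.mem_top : p + s ∈ P ⊔ R)
  have h₁ := hPQR.2 p₁ hp₁ r hr (by rwa [hsum]) (by rwa [hsum])
  have hr_eq : (p - p₁) + s = r := by
    rw [sub_add_eq_add_sub, ← hsum, add_sub_cancel_left]
  have hr0 : r ≠ 0 := by
    rintro rfl
    simp at h₁
  have h₂ := hPRS.2 (p - p₁) (P.sub_mem hp hp₁) s hs (by rwa [hr_eq]) (by rwa [hr_eq])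
  have hiso : ω p₁ (p - p₁) = 0 := hP.2 p₁ hp₁ _ (P.sub_mem hp hp₁)
  rw [← hr_eq, map_add, hiso] at h₁
  rw [map_sub, LinearMap.sub_apply] at h₂
  linarith

theorem MaslovMax.map {P Q R : Submodule ℝ V} (g : V ≃ₗ[ℝ] V)
    (hg : ∀ v w : V, ω (g v) (g w) = ω v w) (h : MaslovMax ω P Q R) :
    MaslovMax ω (P.map g.toLinearMap) (Q.map g.toLinearMap) (R.map g.toLinearMap) := by
  obtain ⟨hPR, Inv, hInvP, hInvR, hpos⟩ := h
  refine ⟨?_, g.toLinearMap ∘ₗ Inv ∘ₗ g.symm.toLinearMap, ?_, ?_, ?_⟩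
  · rw [← Submodule.map_inf _ g.injective, hPR, Submodule.map_bot]
  · rintro _ ⟨v, hv, rfl⟩
    simp [hInvP v hv]
  · rintro _ ⟨v, hv, rfl⟩
    simp [hInvR v hv]
  · rintro _ ⟨v, hv, rfl⟩ hne
    have hv0 : v ≠ 0 := by
      rintro rfl
      simp at hne
    simpa [hg] using hpos v hv hv0

theorem maslovMax_map_iff {P Q R : Submodule ℝ V} (g : V ≃ₗ[ℝ] V)
    (hg : ∀ v w : V, ω (g v) (g w) = ω v w) :
    MaslovMax ω P Q R ↔
      MaslovMax ω (P.map g.toLinearMap) (Q.map g.toLinearMap) (R.map g.toLinearMap) := by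
  refine ⟨MaslovMax.map g hg, fun h => ?_⟩
  have hback := h.map g.symm fun v w => by
    rw [← hg, g.apply_symm_apply, g.apply_symm_apply]
  simpa only [← Submodule.map_comp, LinearEquiv.symm_comp, Submodule.map_id] using hback

end MaslovMax

/-- the relation `⟨P,Q,R⟩ ⟺ M(P,Q,R) = n` is a partial cyclic order on the
set of Lagrangians of a `2n`-dimensional real symplectic vector space, invariant under the
symplectic group. -/
theorem maslov_is_pco {V : Type*} [AddCommGroup V] [Module ℝ V] [FiniteDimensional ℝ V]
    (n : ℕ) (hn : 1 ≤ n) (hdim : finrank ℝ V = 2 * n)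
    (ω : LinearMap.BilinForm ℝ V)
    (halt : ∀ v : V, ω v v = 0)
    (hnd : ∀ v : V, (∀ w : V, ω v w = 0) → v = 0) :
    (∀ P Q R : Submodule ℝ V, IsLagrangian ω n P → IsLagrangian ω n Q → IsLagrangian ω n R →
      MaslovMax ω P Q R → MaslovMax ω Q R P) ∧
    (∀ P Q R : Submodule ℝ V, IsLagrangian ω n P → IsLagrangian ω n Q → IsLagrangian ω n R →
      MaslovMax ω P Q R → ¬ MaslovMax ω R Q P) ∧
    (∀ P Q R S : Submodule ℝ V, IsLagrangian ω n P → IsLagrangian ω n Q →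
      IsLagrangian ω n R → IsLagrangian ω n S →
      MaslovMax ω P Q R → MaslovMax ω P R S → MaslovMax ω P Q S) ∧
    (∀ P Q R : Submodule ℝ V, IsLagrangian ω n P → IsLagrangian ω n Q → IsLagrangian ω n R →
      ∀ g : V ≃ₗ[ℝ] V, (∀ v w : V, ω (g v) (g w) = ω v w) →
      (MaslovMax ω P Q R ↔
        MaslovMax ω (P.map g.toLinearMap) (Q.map g.toLinearMap) (R.map g.toLinearMap))) := by
  exact ⟨fun _ _ _ hP hQ hR h => h.cyclic hdim halt hP hQ hR,
    fun _ _ _ hP hQ hR h => h.not_reverse hn hdim halt hP hQ hR,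
    fun _ _ _ _ hP _ hR hS h₁ h₂ => h₁.trans hdim halt hP hR hS h₂,
    fun _ _ _ _ _ _ g hg => maslovMax_map_iff g hg⟩
end

section
/- Let P,Q be transverse Lagrangians in a 2n-dimensional real symplectic vector space (V,ω) and let v ∈ V be nonzero. Then B_{P,Q}(v,v) > 0 if and only if there exists a Lagrangian subspace L of V with v ∈ L such that B_{P,Q} restricted to L is positive definite. (Equivalently, the positive halfspace H_{P,Q} is the union of the projectivizations of the Lagrangians in the interval (P,Q).) -/
open Module

/-- A linear functional positive at `p` is represented at `p` by some inner product. -/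
lemma exists_posDef_symm_apply_eq {E : Type*} [AddCommGroup E] [Module ℝ E]
    [FiniteDimensional ℝ E] (f : E →ₗ[ℝ] ℝ) (p : E) (hp : 0 < f p) :
    ∃ S : E →ₗ[ℝ] E →ₗ[ℝ] ℝ, (∀ x y, S x y = S y x) ∧ (∀ x, x ≠ 0 → 0 < S x x) ∧ S p = f := by
  let b := finBasis ℝ E
  let g : E →ₗ[ℝ] E →ₗ[ℝ] ℝ := ∑ i, (b.coord i).smulRight (b.coord i)
  have hg : ∀ x y, g x y = ∑ i, b.repr x i * b.repr y i := fun x y ↦ by simp [g]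
  have hg_nonneg : ∀ x, 0 ≤ g x x := fun x ↦ by
    rw [hg]
    exact Finset.sum_nonneg fun i _ ↦ mul_self_nonneg _
  have hg_zero : ∀ x, g x x = 0 → x = 0 := fun x hx ↦ by
    rw [hg, Finset.sum_eq_zero_iff_of_nonneg fun i _ ↦ mul_self_nonneg _] at hx
    exact b.ext_elem fun i ↦ by simpa using hx i (Finset.mem_univ i)
  let π : E →ₗ[ℝ] E := LinearMap.id - (f p)⁻¹ • f.smulRight p
  have hπ : ∀ x, π x = x - (f p)⁻¹ • f x • p := fun x ↦ by simp [π]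
  let S : E →ₗ[ℝ] E →ₗ[ℝ] ℝ := (f p)⁻¹ • f.smulRight f + g.compl₁₂ π π
  have hS : ∀ x y, S x y = (f p)⁻¹ * (f x * f y) + g (π x) (π y) := fun x y ↦ by simp [S]
  refine ⟨S, fun x y ↦ ?_, fun x hx ↦ ?_, ?_⟩
  · simp only [hS, hg, mul_comm]
  · rw [hS]
    by_cases hfx : f x = 0
    · have hπx : π x = x := by simp [hπ, hfx]
      rw [hfx, hπx]
      simpa using lt_of_le_of_ne (hg_nonneg x) fun h ↦ hx (hg_zero x h.symm)
    · have := hg_nonneg (π x)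
      have := mul_pos (inv_pos.2 hp) (mul_self_pos.2 hfx)
      linarith
  · ext y
    have hπp : π p = 0 := by simp [hπ, smul_smul, hp.ne']
    simp [hS, hπp, hp.ne']

/-- for a transverse pair of Lagrangians `P, Q` with reflection
`Inv = Inv_{P,Q}` and a nonzero vector `v`, we have `B_{P,Q}(v,v) > 0` if and only if `v`
lies in a Lagrangian `L` on which `B_{P,Q}` is positive definite.  (The positive halfspace
`H_{P,Q}` is the union of the projectivizations of the Lagrangians in the interval
`(P,Q)`.) -/
theorem halfspace_is_union_of_lagrangians {V : Type*} [AddCommGroup V] [Module ℝ V]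
    [FiniteDimensional ℝ V]
    (n : ℕ) (hn : 1 ≤ n) (hdim : finrank ℝ V = 2 * n)
    (ω : LinearMap.BilinForm ℝ V)
    (halt : ∀ v : V, ω v v = 0)
    (hnd : ∀ v : V, (∀ w : V, ω v w = 0) → v = 0)
    (P Q : Submodule ℝ V) (hP : IsLagrangian ω n P) (hQ : IsLagrangian ω n Q)
    (htrans : P ⊓ Q = ⊥)
    (Inv : V →ₗ[ℝ] V)
    (hInvP : ∀ v ∈ P, Inv v = -v) (hInvQ : ∀ v ∈ Q, Inv v = v)
    (v : V) (hv : v ≠ 0) :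
    0 < ω v (Inv v) ↔
      ∃ L : Submodule ℝ V, IsLagrangian ω n L ∧ v ∈ L ∧
        ∀ w ∈ L, w ≠ 0 → 0 < ω w (Inv w) := by
  have hanti : ∀ x y, ω x y = -ω y x := fun x y ↦ by
    have h := halt (x + y)
    simp only [map_add, LinearMap.add_apply, halt] at h
    linarith
  have hsup : P ⊔ Q = ⊤ := by
    apply Submodule.eq_top_of_finrank_eq
    have h := Submodule.finrank_sup_add_finrank_inf_eq P Q
    rw [htrans, finrank_bot, hP.1, hQ.1] at h
    omega
  have hform : ∀ x ∈ P, ∀ y ∈ Q, ω (x + y) (Inv (x + y)) = 2 * ω x y := fun x hx y hy ↦ by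
    simp only [map_add, LinearMap.add_apply, hInvP x hx, hInvQ y hy, map_neg, halt]
    rw [hanti y x]
    ring
  refine ⟨fun hpos ↦ ?_, fun ⟨L, _, hvL, hL⟩ ↦ hL v hvL hv⟩
  obtain ⟨p, hp, q, hq, rfl⟩ := Submodule.mem_sup.1 (hsup ▸ Submodule.mem_top : v ∈ P ⊔ Q)
  rw [hform p hp q hq] at hpos
  let φ : Q →ₗ[ℝ] Dual ℝ P := ω.flip.compl₁₂ Q.subtype P.subtype
  have hφ : ∀ (y : Q) (x : P), φ y x = ω x y := fun y x ↦ rfl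
  have hφ_inj : Function.Injective φ := by
    rw [injective_iff_map_eq_zero]
    refine fun y hy ↦ Subtype.ext (hnd y fun w ↦ ?_)
    obtain ⟨a, ha, c, hc, rfl⟩ := Submodule.mem_sup.1 (hsup ▸ Submodule.mem_top : w ∈ P ⊔ Q)
    have h : ω a y = 0 := by rw [← hφ y ⟨a, ha⟩, hy, LinearMap.zero_apply]
    rw [map_add, hQ.2 y y.2 c hc, hanti, h, neg_zero, add_zero]
  let e : Q ≃ₗ[ℝ] Dual ℝ P := φ.linearEquivOfInjective hφ_inj
    (by rw [Subspace.dual_finrank_eq, hP.1, hQ.1])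
  obtain ⟨S, hS_symm, hS_pos, hS_p⟩ := exists_posDef_symm_apply_eq (φ ⟨q, hq⟩) ⟨p, hp⟩
    (by rw [hφ]; simpa using hpos)
  let A : P →ₗ[ℝ] Q := e.symm ∘ₗ S
  have hA : ∀ x y : P, ω x (A y) = S y x := fun x y ↦ by
    rw [← hφ]
    exact LinearMap.congr_fun (e.apply_symm_apply (S y)) x
  have hA_p : A ⟨p, hp⟩ = ⟨q, hq⟩ := by
    change e.symm (S ⟨p, hp⟩) = _
    rw [hS_p]
    exact e.symm_apply_apply ⟨q, hq⟩
  let Γ : P →ₗ[ℝ] V := P.subtype + Q.subtype ∘ₗ A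
  have hΓ : ∀ x, Γ x = (x : V) + A x := fun x ↦ rfl
  have hΓ_inj : Function.Injective Γ := by
    rw [injective_iff_map_eq_zero]
    refine fun x hx ↦ Subtype.ext ?_
    have hxQ : (x : V) ∈ Q := by
      rw [eq_neg_of_add_eq_zero_left ((hΓ x).symm.trans hx)]
      exact Q.neg_mem (A x).2
    exact (Submodule.mem_bot ℝ).1 (htrans ▸ Submodule.mem_inf.2 ⟨x.2, hxQ⟩)
  refine ⟨LinearMap.range Γ, ⟨?_, ?_⟩, ⟨⟨p, hp⟩, by rw [hΓ, hA_p]⟩, ?_⟩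
  · rw [LinearMap.finrank_range_of_inj hΓ_inj, hP.1]
  · rintro _ ⟨x, rfl⟩ _ ⟨y, rfl⟩
    simp only [hΓ, map_add, LinearMap.add_apply]
    rw [hP.2 x x.2 y y.2, hQ.2 _ (A x).2 _ (A y).2, hA, hanti (A x) y, hA, hS_symm]
    ring
  · rintro _ ⟨x, rfl⟩ hx
    rw [hΓ, hform x x.2 _ (A x).2, hA]
    exact mul_pos two_pos (hS_pos x fun h ↦ hx (by rw [h, map_zero]))
end
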